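/- Let K be a field, m a positive integer not divisible by the characteristic of K, and r a nonzero element of K. Let M = Cir_m^r(w_1, …, w_m) be the m×m r-circulant matrix over K and set w(x) = Σ_{i=0}^{m−1} w_{i+1} x^i. Then rank_K(M) = m − deg gcd(w(x), x^m − r), where the gcd is taken in K[x]. -/

import Mathlib

/-- The `m × m` `r`-circulant matrix with first row `w 0, …, w (m-1)`:
its `(i,j)` entry is `w (j-i)` when `j ≥ i` and `r * w (m+j-i)` when `j < i`
(here `j - i` is subtraction in `Fin m`, i.e. mod `m`). -/
def rCirculant {K : Type*} [Field K] {m : ℕ} (r : K) (w : Fin m → K) :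
    Matrix (Fin m) (Fin m) K :=
  Matrix.of fun i j => if (i : ℕ) ≤ (j : ℕ) then w (j - i) else r * w (j - i)

open Polynomial in
theorem rCirculant_toLin_aux {K : Type*} [Field K] {m : ℕ}
    (hm : 0 < m) (r : K) (w : Fin m → K) (A : Type*) [CommRing A] [Algebra K A] (x : A)
    (hx : x ^ m = algebraMap K A r) (i : Fin m) :
    ∑ j, rCirculant r w i j • x ^ (j : ℕ) = (∑ k, algebraMap K A (w k) * x ^ (k : ℕ)) * x ^ (i : ℕ) := by
  have : NeZero m := ⟨hm.ne'⟩
  rw [← Equiv.sum_comp (Equiv.subRight i) (fun k => algebraMap K A (w k) * x ^ (k : ℕ)), Finset.sum_mul]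
  refine Finset.sum_congr rfl fun j _ => ?_
  simp only [Equiv.subRight_apply, rCirculant, Matrix.of_apply, Algebra.smul_def]
  split_ifs with h
  · have : ((j - i : Fin m) : ℕ) = j - i := Fin.sub_val_of_le h
    rw [mul_assoc, ← pow_add, this]
    congr 2
    omega
  · have : ((j - i : Fin m) : ℕ) = m + j - i := by
      rw [Fin.coe_sub_iff_lt.mpr (by simpa using h)]
    have e : ((j - i : Fin m) : ℕ) + i = m + j := by omega
    rw [mul_assoc, ← pow_add, e, pow_add, hx, map_mul]
    ring

/-- If the characteristic of `K` does not divide `m` (i.e. `m ≠ 0` in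
`K`) and `r ≠ 0`, then the rank of the `r`-circulant matrix `Cirₘʳ (w₁, …, wₘ)` equals
`m - deg gcd(w(x), x^m - r)`, where `w(x) = Σ_{i=0}^{m-1} w_{i+1} x^i`. -/
theorem rank_rCirculant_eq {K : Type*} [Field K] [DecidableEq K] {m : ℕ}
    (hm : 0 < m) (hcharK : (m : K) ≠ 0) (r : K) (hr : r ≠ 0) (w : Fin m → K) :
    (rCirculant r w).rank =
      m - (EuclideanDomain.gcd
            (∑ i : Fin m, Polynomial.C (w i) * Polynomial.X ^ (i : ℕ))
            (Polynomial.X ^ m - Polynomial.C r)).natDegree := by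
  set W : Polynomial K := ∑ i : Fin m, Polynomial.C (w i) * Polynomial.X ^ (i : ℕ) with hW
  set f : Polynomial K := Polynomial.X ^ m - Polynomial.C r with hf
  set g := EuclideanDomain.gcd W f with hg
  have hmon : f.Monic := Polynomial.monic_X_pow_sub_C r hm.ne'
  have hdeg : f.natDegree = m := Polynomial.natDegree_X_pow_sub_C
  have hgf : g ∣ f := EuclideanDomain.gcd_dvd_right W f
  have hgW : g ∣ W := EuclideanDomain.gcd_dvd_left W f
  have hg0 : g ≠ 0 := fun h => hmon.ne_zero (by rw [h] at hgf; exact zero_dvd_iff.mp hgf)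
  let pb := AdjoinRoot.powerBasis hmon.ne_zero
  have hpd : pb.dim = m := hdeg
  let B : Module.Basis (Fin m) K (AdjoinRoot f) := pb.basis.reindex (finCongr hpd)
  have hB : ∀ i, B i = AdjoinRoot.root f ^ (i : ℕ) := by
    intro i
    simp [B, pb]
  have hx : AdjoinRoot.root f ^ m = algebraMap K (AdjoinRoot f) r := by
    have : AdjoinRoot.mk f f = 0 := AdjoinRoot.mk_self
    conv at this => lhs; arg 2; rw [hf]
    simpa [sub_eq_zero] using this
  have hWm : AdjoinRoot.mk f W = ∑ k, algebraMap K (AdjoinRoot f) (w k) * AdjoinRoot.root f ^ (k : ℕ) := by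
    simp [hW]
  have hL : Matrix.toLin B B (rCirculant r w).transpose
      = LinearMap.mulLeft K (AdjoinRoot.mk f W) := by
    refine B.ext fun i => ?_
    rw [Matrix.toLin_self, LinearMap.mulLeft_apply, hWm, hB,
      ← rCirculant_toLin_aux hm r w (AdjoinRoot f) _ hx i]
    simp [hB]
  have hfin : Module.finrank K (AdjoinRoot f) = m := by
    rw [Module.finrank_eq_card_basis B, Fintype.card_fin]
  have : FiniteDimensional K (AdjoinRoot f) := B.finiteDimensional_of_finite
  rw [← Matrix.rank_transpose, Matrix.rank_eq_finrank_range_toLin _ B B, hL]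
  let φ : AdjoinRoot f →ₐ[K] AdjoinRoot g :=
    AdjoinRoot.liftAlgHom f (Algebra.ofId K _) (AdjoinRoot.root g) (by
      have : AdjoinRoot.mk g f = 0 := AdjoinRoot.mk_eq_zero.mpr hgf
      rw [← AdjoinRoot.aeval_eq] at this
      exact this)
  have hφ : ∀ p, φ (AdjoinRoot.mk f p) = AdjoinRoot.mk g p := by
    intro p
    rw [← AdjoinRoot.aeval_eq, ← AdjoinRoot.aeval_eq, ← Polynomial.aeval_algHom_apply]
    have hr : φ (AdjoinRoot.root f) = AdjoinRoot.root g := AdjoinRoot.liftAlgHom_root ..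
    rw [hr]
  have hsurj : LinearMap.range φ.toLinearMap = ⊤ := by
    rw [LinearMap.range_eq_top]
    intro y
    obtain ⟨p, rfl⟩ := AdjoinRoot.mk_surjective y
    exact ⟨AdjoinRoot.mk f p, hφ p⟩
  have hker : LinearMap.ker φ.toLinearMap
      = LinearMap.range (LinearMap.mulLeft K (AdjoinRoot.mk f W)) := by
    ext y
    obtain ⟨p, rfl⟩ := AdjoinRoot.mk_surjective y
    rw [LinearMap.mem_ker, AlgHom.toLinearMap_apply, hφ, AdjoinRoot.mk_eq_zero, LinearMap.mem_range]
    constructor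
    · rintro ⟨c, rfl⟩
      refine ⟨AdjoinRoot.mk f (EuclideanDomain.gcdA W f * c), ?_⟩
      rw [LinearMap.mulLeft_apply, ← map_mul, hg, EuclideanDomain.gcd_eq_gcd_ab W f]
      simp only [map_mul, map_add, AdjoinRoot.mk_self]
      ring
    · rintro ⟨z, hz⟩
      obtain ⟨q, rfl⟩ := AdjoinRoot.mk_surjective z
      rw [LinearMap.mulLeft_apply, ← map_mul, AdjoinRoot.mk_eq_mk] at hz
      have h1 := hgf.trans hz
      exact (dvd_sub_right (hgW.mul_right q)).mp h1
  have h := LinearMap.finrank_range_add_finrank_ker φ.toLinearMap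
  rw [hsurj, finrank_top, hker, hfin, (AdjoinRoot.powerBasis hg0).finrank,
    AdjoinRoot.powerBasis_dim] at h
  omega
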